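/- Let P be a finite partial IP loop satisfying condition (4). Then the number of edges of the gap graph G(P) is divisible by three; equivalently, 6 divides #Γ(P). -/

import Mathlib

/-- A partial IP loop: a set `carrier` with a partial binary operation defined on
a domain `dom ⊆ carrier ×ˢ carrier` (the value of `mul` is only meaningful on `dom`),
with a unit, unique two-sided inverses, and the inverse property. -/
structure PartialIPLoop (α : Type*) where
  carrier : Set α
  one : α
  dom : Set (α × α)
  mul : α → α → α
  inv : α → α
  one_mem : one ∈ carrier
  dom_subset : dom ⊆ carrier ×ˢ carrier
  mul_mem : ∀ x y, (x, y) ∈ dom → mul x y ∈ carrier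
  one_mul_dom : ∀ x ∈ carrier, (one, x) ∈ dom
  mul_one_dom : ∀ x ∈ carrier, (x, one) ∈ dom
  one_mul : ∀ x ∈ carrier, mul one x = x
  mul_one : ∀ x ∈ carrier, mul x one = x
  inv_mem : ∀ x ∈ carrier, inv x ∈ carrier
  mul_inv_dom : ∀ x ∈ carrier, (x, inv x) ∈ dom
  inv_mul_dom : ∀ x ∈ carrier, (inv x, x) ∈ dom
  mul_inv : ∀ x ∈ carrier, mul x (inv x) = one
  inv_mul : ∀ x ∈ carrier, mul (inv x) x = one
  inv_unique : ∀ x ∈ carrier, ∀ y ∈ carrier,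
    (x, y) ∈ dom → (y, x) ∈ dom → mul x y = one → mul y x = one → y = inv x
  ip_left_dom : ∀ x y, (x, y) ∈ dom → (inv x, mul x y) ∈ dom
  ip_right_dom : ∀ x y, (x, y) ∈ dom → (mul x y, inv y) ∈ dom
  ip_left : ∀ x y, (x, y) ∈ dom → mul (inv x) (mul x y) = y
  ip_right : ∀ x y, (x, y) ∈ dom → mul (mul x y) (inv y) = x

namespace PartialIPLoop

variable {α : Type*}

/-- The set of gaps `Γ(P) = (P × P) \ D(P)`. -/
def gaps (P : PartialIPLoop α) : Set (α × α) :=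
  (P.carrier ×ˢ P.carrier) \ P.dom

/-- The set `O₂(P)` of elements of order two. -/
def O2 (P : PartialIPLoop α) : Set α :=
  {x ∈ P.carrier | x ≠ P.one ∧ (x, x) ∈ P.dom ∧ P.mul x x = P.one}

/-- The set `O₃(P)` of elements of order three. -/
def O3 (P : PartialIPLoop α) : Set α :=
  {x ∈ P.carrier | x ≠ P.one ∧ (x, x) ∈ P.dom ∧ (x, P.mul x x) ∈ P.dom ∧
    P.mul x (P.mul x x) = P.one}

/-- `Q` is an extension of `P`: `P ⊆ Q`, `D(P) ⊆ D(Q)`, and the operations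
agree on `D(P)`. -/
def Ext (P Q : PartialIPLoop α) : Prop :=
  P.carrier ⊆ Q.carrier ∧ P.dom ⊆ Q.dom ∧
    ∀ x y, (x, y) ∈ P.dom → P.mul x y = Q.mul x y

end PartialIPLoop

/-- A self-map of a finite set whose `p ^ n`-th iterate is the identity has, modulo the prime `p`,
as many fixed points as the set has elements. -/
theorem Set.ncard_modEq_ncard_fixed {β : Type*} {S : Set β} (hS : S.Finite) {f : β → β}
    (hf : Set.MapsTo f S S) {p n : ℕ} [Fact p.Prime] (hp : ∀ x ∈ S, f^[p ^ n] x = x) :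
    S.ncard ≡ {x ∈ S | f x = x}.ncard [MOD p] := by
  classical
  have := hS.fintype
  let g : Function.End S := hf.restrict f S S
  have hg : g ^ p ^ n = 1 := by
    have key : ∀ k, ∀ x : S, (((g ^ k) x : S) : β) = f^[k] x := by
      intro k
      induction k with
      | zero => intro x; rfl
      | succ k ih =>
        intro x
        rw [pow_succ, Function.iterate_succ_apply]
        exact ih (g x)
    funext x
    exact Subtype.ext ((key _ x).trans (hp x x.2))
  have h := Equiv.Perm.card_fixedPoints_modEq hg
  rw [← Nat.card_eq_fintype_card, ← Nat.card_eq_fintype_card, Nat.card_coe_set_eq,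
    Nat.card_coe_set_eq] at h
  convert h using 1
  rw [← Set.ncard_image_of_injective (Function.fixedPoints g) Subtype.val_injective]
  congr 1
  ext x
  simp [Function.mem_fixedPoints, Function.IsFixedPt, Subtype.ext_iff, g, and_comm]

namespace PartialIPLoop

variable {α : Type*}

theorem mem_of_dom_left (P : PartialIPLoop α) {x y : α} (h : (x, y) ∈ P.dom) : x ∈ P.carrier :=
  (P.dom_subset h).1

theorem mem_of_dom_right (P : PartialIPLoop α) {x y : α} (h : (x, y) ∈ P.dom) : y ∈ P.carrier :=
  (P.dom_subset h).2

theorem inv_inv (P : PartialIPLoop α) {x : α} (hx : x ∈ P.carrier) : P.inv (P.inv x) = x :=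
  (P.inv_unique _ (P.inv_mem x hx) x hx (P.inv_mul_dom x hx) (P.mul_inv_dom x hx)
    (P.inv_mul x hx) (P.mul_inv x hx)).symm

theorem inv_one (P : PartialIPLoop α) : P.inv P.one = P.one :=
  (P.inv_unique _ P.one_mem _ P.one_mem (P.one_mul_dom _ P.one_mem) (P.one_mul_dom _ P.one_mem)
    (P.one_mul _ P.one_mem) (P.one_mul _ P.one_mem)).symm

theorem inv_eq_of_mem_O2 (P : PartialIPLoop α) {x : α} (hx : x ∈ P.O2) : P.inv x = x :=
  (P.inv_unique x hx.1 x hx.1 hx.2.2.1 hx.2.2.1 hx.2.2.2 hx.2.2.2).symm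

/-- The rotation `(x, y) ↦ ((xy)⁻¹, x)` of multiplicable pairs. -/
def rot (P : PartialIPLoop α) (q : α × α) : α × α := (P.inv (P.mul q.1 q.2), q.1)

theorem rot_mem_dom (P : PartialIPLoop α) {q : α × α} (h : q ∈ P.dom) : P.rot q ∈ P.dom := by
  have := P.ip_left_dom _ _ (P.ip_right_dom q.1 q.2 h)
  rwa [P.ip_right q.1 q.2 h] at this

theorem mul_rot (P : PartialIPLoop α) {q : α × α} (h : q ∈ P.dom) :
    P.mul (P.rot q).1 (P.rot q).2 = P.inv q.2 := by
  have := P.ip_left _ _ (P.ip_right_dom q.1 q.2 h)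
  rwa [P.ip_right q.1 q.2 h] at this

theorem rot_rot (P : PartialIPLoop α) {q : α × α} (h : q ∈ P.dom) :
    P.rot (P.rot q) = (q.2, P.inv (P.mul q.1 q.2)) := by
  have : P.rot (P.rot q) = (P.inv (P.mul (P.rot q).1 (P.rot q).2), (P.rot q).1) := rfl
  rw [this, P.mul_rot h, P.inv_inv (P.dom_subset h).2]
  rfl

theorem rot_rot_rot (P : PartialIPLoop α) {q : α × α} (h : q ∈ P.dom) :
    P.rot (P.rot (P.rot q)) = q := by
  rw [P.rot_rot (P.rot_mem_dom h), P.mul_rot h, P.inv_inv (P.dom_subset h).2]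
  rfl

theorem inv_inv_mem_dom (P : PartialIPLoop α) {x y : α} (h : (x, y) ∈ P.dom) :
    (P.inv y, P.inv x) ∈ P.dom := by
  have := P.ip_right_dom _ _ (P.rot_mem_dom h)
  exact P.mul_rot h ▸ this

theorem rot_fixed (P : PartialIPLoop α) :
    {q ∈ P.dom | P.rot q = q} = (fun x => (x, x)) '' insert P.one P.O3 := by
  ext ⟨x, y⟩
  simp only [Set.mem_ofPred_eq, rot, Prod.mk.injEq, Set.mem_image, Set.mem_insert_iff]
  constructor
  · rintro ⟨hd, hinv, rfl⟩
    have hx := P.mem_of_dom_left hd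
    refine ⟨x, or_iff_not_imp_left.2 fun h1 => ?_, rfl, rfl⟩
    have hxx : P.mul x x = P.inv x := by
      rw [← P.inv_inv (P.mul_mem _ _ hd), hinv]
    refine ⟨hx, h1, hd, ?_, ?_⟩
    · rw [hxx]; exact P.mul_inv_dom x hx
    · rw [hxx]; exact P.mul_inv x hx
  · rintro ⟨z, hz, rfl, rfl⟩
    rcases hz with rfl | ⟨hz, -, hd, hd', h⟩
    · exact ⟨P.one_mul_dom _ P.one_mem, by rw [P.one_mul _ P.one_mem, P.inv_one], rfl⟩
    · refine ⟨hd, ?_, rfl⟩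
      have := P.ip_left _ _ hd'
      rw [h, P.mul_one _ (P.inv_mem _ hz)] at this
      rw [← this, P.inv_inv hz]

theorem ncard_dom_modEq (P : PartialIPLoop α) (hP : P.carrier.Finite) :
    P.dom.ncard ≡ P.O3.ncard + 1 [MOD 3] := by
  have hO : P.O3.Finite := hP.subset fun x hx => hx.1
  have h := Set.ncard_modEq_ncard_fixed (p := 3) (n := 1) ((hP.prod hP).subset P.dom_subset)
    (fun q hq => P.rot_mem_dom hq) (fun q hq => P.rot_rot_rot hq)
  rwa [P.rot_fixed, Set.ncard_image_of_injective _ fun x y h => congrArg Prod.fst h,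
    Set.ncard_insert_of_notMem (fun h => h.2.1 rfl) hO] at h

theorem two_dvd_ncard_gaps (P : PartialIPLoop α) (hP : P.carrier.Finite)
    (hgap : P.gaps ⊆ P.O2 ×ˢ P.O2) : 2 ∣ P.gaps.ncard := by
  have hswap : Set.MapsTo Prod.swap P.gaps P.gaps := by
    rintro ⟨x, y⟩ h
    refine ⟨⟨h.1.2, h.1.1⟩, fun hd => h.2 ?_⟩
    have := P.inv_inv_mem_dom hd
    rwa [P.inv_eq_of_mem_O2 (hgap h).1, P.inv_eq_of_mem_O2 (hgap h).2] at this
  have hfin : P.gaps.Finite := (hP.prod hP).subset Set.sdiff_subset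
  have h := Set.ncard_modEq_ncard_fixed (p := 2) (n := 1) hfin hswap fun _ _ => rfl
  have hempty : {q ∈ P.gaps | Prod.swap q = q} = ∅ := by
    refine Set.eq_empty_of_forall_notMem ?_
    rintro ⟨x, y⟩ ⟨hq, he⟩
    obtain rfl : y = x := congrArg Prod.fst he
    exact hq.2 (hgap hq).1.2.2.1
  rw [hempty, Set.ncard_empty] at h
  exact (Nat.modEq_zero_iff_dvd).1 h

end PartialIPLoop

/-- Claim 3(b): if `P` is a finite partial IP loop satisfying condition (4), then
the number of edges of the gap graph is divisible by three, i.e. `6 ∣ #Γ(P)`. -/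
theorem six_dvd_gaps_card {α : Type*} (P : PartialIPLoop α)
    (hP : P.carrier.Finite) (h3 : 3 ∣ P.O3.ncard)
    (h10 : 10 ≤ P.carrier.ncard) (hmod : P.carrier.ncard % 6 = 4)
    (hgap : P.gaps ⊆ P.O2 ×ˢ P.O2) :
    6 ∣ P.gaps.ncard := by
  have h2 := P.two_dvd_ncard_gaps hP hgap
  have hdom := P.ncard_dom_modEq hP
  have hsum : P.gaps.ncard + P.dom.ncard = (P.carrier ×ˢ P.carrier).ncard :=
    Set.ncard_sdiff_add_ncard_of_subset P.dom_subset (hP.prod hP)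
  have hsq : P.carrier.ncard * P.carrier.ncard ≡ 1 * 1 [MOD 3] := by
    have h : P.carrier.ncard ≡ 1 [MOD 3] := by unfold Nat.ModEq; omega
    exact h.mul h
  rw [Set.ncard_prod] at hsum
  unfold Nat.ModEq at hdom hsq
  omega
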